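/- arXiv:2101.02759 — 2 statements merged into one kernel-verified Lean document; each statement's English description precedes it below -/
import Mathlib

section
/- Let g be a finite-dimensional complex semisimple Lie algebra and let ζ ∈ g be an element such that ad ζ is a diagonalizable endomorphism of g. If e ∈ g is nonzero and ⁅ζ, e⁆ = e, then there exist h, f ∈ g such that (h, e, f) is an sl₂-triple with ⁅ζ, h⁆ = 0 and ⁅ζ, f⁆ = −f. (Graded Jacobson–Morozov theorem of §2.4: any nonzero element of the degree-1 piece g₁ of a ℤ-grading can be completed to an sl₂-triple with h ∈ g₀ and f ∈ g₋₁.) -/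
/-- An `sl₂`-triple `(h, e, f)` in a Lie algebra: `⁅h,e⁆ = 2e`, `⁅h,f⁆ = -2f`, `⁅e,f⁆ = h`. -/
def IsSl2TripleIn {g : Type*} [LieRing g] [LieAlgebra ℂ g] (h e f : g) : Prop :=
  ⁅h, e⁆ = (2 : ℂ) • e ∧ ⁅h, f⁆ = (-2 : ℂ) • f ∧ ⁅e, f⁆ = h

theorem Commute.pow_succ_mul_sub_mul_pow_succ {R : Type*} [Ring R] {a x y : R}
    (hxy : a * x - x * a = y) (hay : Commute a y) (k : ℕ) :
    a ^ (k + 1) * x - x * a ^ (k + 1) = (k + 1) • (a ^ k * y) := by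
  induction k with
  | zero => simpa using hxy
  | succ k ih =>
    calc a ^ (k + 1 + 1) * x - x * a ^ (k + 1 + 1)
        = a * (a ^ (k + 1) * x - x * a ^ (k + 1)) + (a * x - x * a) * a ^ (k + 1) := by
          rw [pow_succ' a (k + 1)]; noncomm_ring
      _ = (k + 1 + 1) • (a ^ (k + 1) * y) := by
          rw [ih, hxy, ← (hay.pow_left (k + 1)).eq, mul_smul_comm, ← mul_assoc, ← pow_succ',
            succ_nsmul _ (k + 1)]

/-- Jacobson's lemma: a commutator `a * x - x * a` commuting with a nilpotent `a` is nilpotent. -/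
theorem IsNilpotent.commutator_of_commute {R : Type*} [Ring R] [IsAddTorsionFree R] {a x y : R}
    (ha : IsNilpotent a) (hxy : a * x - x * a = y) (hay : Commute a y) : IsNilpotent y := by
  obtain ⟨n, hn⟩ := ha
  suffices ∀ k m : ℕ, a ^ k * y ^ m = 0 → IsNilpotent y from this n 0 (by simp [hn])
  intro k
  induction k with
  | zero => exact fun m hm ↦ ⟨m, by simpa using hm⟩
  | succ k ih =>
    intro m hm
    have hm' : y ^ m * a ^ (k + 1) = 0 := by rw [← (hay.pow_pow (k + 1) m).eq, hm]
    apply ih (m + 1 + m)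
    have key : (k + 1) • (y ^ m * (a ^ k * y) * y ^ m) = 0 := by
      rw [← smul_mul_assoc, ← mul_smul_comm, ← hay.pow_succ_mul_sub_mul_pow_succ hxy k]
      calc y ^ m * (a ^ (k + 1) * x - x * a ^ (k + 1)) * y ^ m
          = y ^ m * a ^ (k + 1) * x * y ^ m - y ^ m * x * (a ^ (k + 1) * y ^ m) := by noncomm_ring
        _ = 0 := by rw [hm, hm']; simp
    rw [smul_eq_zero_iff_right k.succ_ne_zero] at key
    rw [pow_add, pow_succ', ← mul_assoc, ← mul_assoc]
    rw [← mul_assoc, ← (hay.pow_pow k m).eq] at key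
    simpa only [mul_assoc, (Commute.self_pow y m).eq] using key

namespace Module.End

variable {K V : Type*} [Field K] [AddCommGroup V] [Module K V]

theorem isNilpotent_of_mul_sub_mul_eq_self [CharZero K] [FiniteDimensional K V]
    {z a : Module.End K V} (h : z * a - a * z = a) : IsNilpotent a := by
  let D : Module.End K (Module.End K V) := LinearMap.mulLeft K z - LinearMap.mulRight K z
  have hD (k : ℕ) : D (a ^ k) = (k : K) • a ^ k := by
    induction k with
    | zero => simp [D]
    | succ k ih =>
      simp only [D, LinearMap.sub_apply, LinearMap.mulLeft_apply, LinearMap.mulRight_apply] at ih ⊢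
      calc z * a ^ (k + 1) - a ^ (k + 1) * z
          = (z * a ^ k - a ^ k * z) * a + a ^ k * (z * a - a * z) := by
            rw [pow_succ]; noncomm_ring
        _ = ((k + 1 : ℕ) : K) • a ^ (k + 1) := by
            rw [ih, h, smul_mul_assoc, ← pow_succ]; push_cast; rw [add_smul, one_smul]
  by_contra hnil
  refine Set.infinite_univ (α := ℕ) (((finite_hasEigenvalue D).preimage
    (f := ((↑) : ℕ → K)) Nat.cast_injective.injOn).subset fun k _ ↦ ?_)
  exact hasEigenvalue_of_hasEigenvector
    ⟨mem_eigenspace_iff.mpr (hD k), fun hk ↦ hnil ⟨k, hk⟩⟩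

theorem isCompl_eigenspace_range_sub [FiniteDimensional K V] {z : Module.End K V}
    (hz : ⨆ μ, z.eigenspace μ = ⊤) (μ : K) :
    IsCompl (z.eigenspace μ) (LinearMap.range (z - algebraMap K (Module.End K V) μ)) := by
  have hsup : z.eigenspace μ ⊔ LinearMap.range (z - algebraMap K (Module.End K V) μ) = ⊤ := by
    rw [eq_top_iff, ← hz]
    refine iSup_le fun ν v hv ↦ ?_
    rw [mem_eigenspace_iff] at hv
    by_cases hνμ : ν = μ
    · exact Submodule.mem_sup_left (mem_eigenspace_iff.mpr (hνμ ▸ hv))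
    · refine Submodule.mem_sup_right ⟨(ν - μ)⁻¹ • v, ?_⟩
      rw [map_smul, LinearMap.sub_apply, hv, algebraMap_end_apply, ← sub_smul,
        inv_smul_smul₀ (sub_ne_zero.mpr hνμ)]
  refine ⟨?_, codisjoint_iff.mpr hsup⟩
  have h1 := Submodule.finrank_sup_add_finrank_inf_eq (z.eigenspace μ)
    (LinearMap.range (z - algebraMap K (Module.End K V) μ))
  have h2 := LinearMap.finrank_range_add_finrank_ker (z - algebraMap K (Module.End K V) μ)
  rw [Algebra.algebraMap_eq_smul_one, ← eigenspace_def, ← Algebra.algebraMap_eq_smul_one] at h2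
  rw [hsup, finrank_top] at h1
  rw [disjoint_iff, ← Submodule.finrank_eq_zero (R := K)]
  omega

/-- If `b` maps the `μ`-eigenspace of a diagonalizable `z` to the `ν`-eigenspace and shifts
eigenvalues by `ν - μ`, then the `μ`-component of `x` has the same image under `b` as `x`, as soon
as `b x` lies in the `ν`-eigenspace. -/
theorem exists_eigenvector_add_of_apply_mem_eigenspace [FiniteDimensional K V]
    {z b : Module.End K V} (hz : ⨆ μ, z.eigenspace μ = ⊤) {μ ν : K}
    (hb : z * b - b * z = (ν - μ) • b) {x : V} (hx : z (b x) = ν • b x) :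
    ∃ y u, z y = μ • y ∧ x = y + (z u - μ • u) ∧ b y = b x := by
  have hb' (v : V) : z (b v) = b (z v) + (ν - μ) • b v := by
    have := LinearMap.congr_fun hb v
    simp only [LinearMap.sub_apply, Module.End.mul_apply, LinearMap.smul_apply] at this
    rw [← this]; abel
  obtain ⟨y, hy, w, ⟨u, rfl⟩, hyu⟩ := Submodule.mem_sup.mp
    ((isCompl_eigenspace_range_sub hz μ).sup_eq_top ▸ Submodule.mem_top : x ∈ _)
  rw [mem_eigenspace_iff] at hy
  simp only [LinearMap.sub_apply, algebraMap_end_apply] at hyu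
  refine ⟨y, u, hy, hyu.symm, ?_⟩
  have h1 : b x - b y ∈ z.eigenspace ν := by
    rw [mem_eigenspace_iff, map_sub, hx, hb' y, hy, map_smul, ← add_smul, add_sub_cancel, smul_sub]
  have h2 : b x - b y ∈ LinearMap.range (z - algebraMap K (Module.End K V) ν) := by
    refine ⟨b u, ?_⟩
    rw [← hyu, LinearMap.sub_apply, algebraMap_end_apply, hb', map_add, map_sub, map_smul]
    module
  exact (sub_eq_zero.mp (Submodule.disjoint_def.mp
    (isCompl_eigenspace_range_sub hz ν).disjoint _ h1 h2)).symm

theorem pow_succ_mul_sub_mul_pow_succ_of_sl2 {a f h : Module.End K V}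
    (hha : h * a - a * h = (2 : K) • a) (haf : a * f - f * a = h) (i : ℕ) :
    a ^ (i + 1) * f - f * a ^ (i + 1) = ((i : K) + 1) • (h * a ^ i - (i : K) • a ^ i) := by
  induction i with
  | zero => simpa using haf
  | succ i ih =>
    have hah : a * h = h * a - (2 : K) • a := by rw [← hha]; abel
    calc a ^ (i + 1 + 1) * f - f * a ^ (i + 1 + 1)
        = a * (a ^ (i + 1) * f - f * a ^ (i + 1)) + (a * f - f * a) * a ^ (i + 1) := by
          rw [pow_succ' a (i + 1)]; noncomm_ring
      _ = _ := by
          rw [ih, haf, mul_smul_comm, mul_sub, ← mul_assoc, hah, mul_smul_comm, sub_mul,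
            smul_mul_assoc, mul_assoc h a, ← pow_succ']
          push_cast
          module

/-- Morozov's lemma: `h` has no eigenvalue `-2` on the kernel of `a`. -/
theorem eq_zero_of_apply_eq_neg_two_smul [CharZero K] {a f h : Module.End K V}
    (ha : IsNilpotent a) (hha : h * a - a * h = (2 : K) • a) (haf : a * f - f * a = h)
    {v : V} (hv : a v = 0) (hhv : h v = (-2 : K) • v) : v = 0 := by
  have hrange (i : ℕ) : v ∈ LinearMap.range (a ^ i) := by
    induction i with
    | zero => simp
    | succ i ih =>
      obtain ⟨u, hu⟩ := ih
      have key := LinearMap.congr_fun (pow_succ_mul_sub_mul_pow_succ_of_sl2 hha haf i) u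
      have hau : (a ^ (i + 1)) u = 0 := by rw [pow_succ', Module.End.mul_apply, hu, hv]
      simp only [LinearMap.sub_apply, Module.End.mul_apply, LinearMap.smul_apply, hu, hau, map_zero,
        sub_zero, hhv, ← sub_smul, smul_smul] at key
      have hne : ((i : K) + 1) * (-2 - i) ≠ 0 := by
        have h1 : ((i : K) + 1) ≠ 0 := by exact_mod_cast i.succ_ne_zero
        have h2 : ((i : K) + 2) ≠ 0 := by exact_mod_cast (i + 1).succ_ne_zero
        rw [show (-2 - i : K) = -(i + 2) by ring]
        exact mul_ne_zero h1 (neg_ne_zero.mpr h2)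
      exact (Submodule.smul_mem_iff _ hne).mp (key ▸ LinearMap.mem_range_self _ _)
  obtain ⟨n, hn⟩ := ha
  simpa [hn, eq_comm] using hrange n

end Module.End

namespace LieAlgebra

variable {K L : Type*} [Field K] [LieRing L] [LieAlgebra K L]

theorem ad_mul_sub_mul (x y : L) :
    ad K L x * ad K L y - ad K L y * ad K L x = ad K L ⁅x, y⁆ := by
  ext z
  simp

theorem isNilpotent_ad_of_lie_eq_self [CharZero K] [FiniteDimensional K L] {ζ e : L}
    (hζe : ⁅ζ, e⁆ = e) : IsNilpotent (ad K L e) :=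
  Module.End.isNilpotent_of_mul_sub_mul_eq_self (z := ad K L ζ) (by rw [ad_mul_sub_mul, hζe])

theorem ad_mul_ad_pow_two_sub {ζ e : L} (hζe : ⁅ζ, e⁆ = e) :
    ad K L ζ * ad K L e ^ 2 - ad K L e ^ 2 * ad K L ζ = (1 - (-1) : K) • ad K L e ^ 2 := by
  ext x
  simp only [pow_two, LinearMap.sub_apply, Module.End.mul_apply, ad_apply, LinearMap.smul_apply]
  rw [leibniz_lie ζ e, leibniz_lie ζ e, hζe, lie_add]
  module

theorem mem_range_ad_pow_two_of_lie_eq_self [CharZero K] [FiniteDimensional K L] [IsKilling K L]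
    {ζ e : L} (hdiag : ⨆ μ : K, Module.End.eigenspace (ad K L ζ) μ = ⊤) (hζe : ⁅ζ, e⁆ = e) :
    e ∈ LinearMap.range (ad K L e ^ 2) := by
  by_contra hmem
  obtain ⟨φ, hφe, hφ⟩ := Submodule.exists_dual_map_eq_bot_of_notMem hmem inferInstance
  obtain ⟨x, rfl⟩ := (killingForm K L).toDual (IsKilling.killingForm_nondegenerate K L)
    |>.surjective φ
  simp only [LinearMap.BilinForm.toDual_def] at hφe
  have hφ' (y : L) : killingForm K L x ⁅e, ⁅e, y⁆⁆ = 0 := by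
    have := Submodule.mem_map_of_mem
      (f := (killingForm K L).toDual (IsKilling.killingForm_nondegenerate K L) x)
      (LinearMap.mem_range_self (ad K L e ^ 2) y)
    rw [hφ] at this
    simpa [pow_two, LinearMap.BilinForm.toDual_def] using this
  have hx : ⁅e, ⁅e, x⁆⁆ = 0 := by
    refine (IsKilling.killingForm_nondegenerate K L).1 _ fun y ↦ ?_
    rw [LieModule.traceForm_apply_lie_apply', LieModule.traceForm_apply_lie_apply', neg_neg]
    exact hφ' y
  obtain ⟨y, u, hy, hxy, hey⟩ := Module.End.exists_eigenvector_add_of_apply_mem_eigenspace hdiag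
    (ad_mul_ad_pow_two_sub hζe) (x := x) (by simp [pow_two, hx])
  simp only [pow_two, Module.End.mul_apply, ad_apply, hx] at hy hey
  apply hφe
  have hu : killingForm K L ⁅ζ, u⁆ e = - killingForm K L u e := by
    rw [LieModule.traceForm_apply_lie_apply', hζe]
  have hζw : ⁅ζ, ⁅e, y⁆⁆ = 0 := by
    rw [leibniz_lie, hζe, hy, lie_smul]; module
  have hw : IsNilpotent (ad K L ⁅e, y⁆) := by
    have := IsAddTorsionFree.of_isTorsionFree K (Module.End K L)
    refine (isNilpotent_ad_of_lie_eq_self hζe).commutator_of_commute (ad_mul_sub_mul e y) ?_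
    rw [commute_iff_eq, ← sub_eq_zero, ad_mul_sub_mul, hey, map_zero]
  have hcomm : Commute (ad K L ζ) (ad K L ⁅e, y⁆) := by
    rw [commute_iff_eq, ← sub_eq_zero, ad_mul_sub_mul, hζw, map_zero]
  have hye : killingForm K L y e = 0 := by
    rw [LieModule.traceForm_comm, ← hζe, LieModule.traceForm_apply_lie_apply,
      killingForm_apply_apply]
    exact (LinearMap.isNilpotent_trace_of_isNilpotent (hcomm.isNilpotent_mul_left hw)).eq_zero
  rw [hxy]
  simp [hye, hu]

theorem exists_sl2_of_lie_eq_self [CharZero K] [FiniteDimensional K L] [IsKilling K L]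
    {ζ e : L} (hdiag : ⨆ μ : K, Module.End.eigenspace (ad K L ζ) μ = ⊤) (hζe : ⁅ζ, e⁆ = e) :
    ∃ h f : L, (⁅h, e⁆ = (2 : K) • e ∧ ⁅h, f⁆ = (-2 : K) • f ∧ ⁅e, f⁆ = h) ∧
      ⁅ζ, h⁆ = 0 ∧ ⁅ζ, f⁆ = -f := by
  obtain ⟨x, hx⟩ := mem_range_ad_pow_two_of_lie_eq_self hdiag hζe
  obtain ⟨y, -, hy, -, hyx⟩ := Module.End.exists_eigenvector_add_of_apply_mem_eigenspace hdiag
    (ad_mul_ad_pow_two_sub hζe) (x := x) (by simp [hx, hζe])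
  rw [hx] at hyx
  simp only [pow_two, Module.End.mul_apply, ad_apply] at hy hyx
  obtain ⟨g, hg, hζg⟩ : ∃ g : L, ⁅⁅e, g⁆, e⁆ = (2 : K) • e ∧ ⁅ζ, g⁆ = -g := by
    refine ⟨(-2 : K) • y, ?_, ?_⟩
    · rw [← lie_skew, lie_smul, lie_smul, hyx]; module
    · rw [lie_smul, hy]; module
  obtain ⟨h, hh⟩ : ∃ h, h = ⁅e, g⁆ := ⟨_, rfl⟩
  rw [← hh] at hg
  have hζh : ⁅ζ, h⁆ = 0 := by rw [hh, leibniz_lie, hζe, hζg, lie_neg, add_neg_cancel]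
  have heh : ⁅e, h⁆ = (-2 : K) • e := by rw [← lie_skew, hg]; module
  have hcomm : ∀ v : L, ⁅ζ, ⁅h, v⁆⁆ = ⁅h, ⁅ζ, v⁆⁆ := fun v ↦ by
    rw [leibniz_lie, hζh, zero_lie, zero_add]
  have hehv : ∀ v : L, ⁅e, ⁅h, v⁆⁆ = (-2 : K) • ⁅e, v⁆ + ⁅h, ⁅e, v⁆⁆ := fun v ↦ by
    rw [leibniz_lie, heh, smul_lie]
  let N : Submodule K L := LinearMap.ker (ad K L e) ⊓ (ad K L ζ).eigenspace (-1)
  have hN {v : L} : v ∈ N ↔ ⁅e, v⁆ = 0 ∧ ⁅ζ, v⁆ = -v := by simp [N]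
  let T : Module.End K L := ad K L h + (2 : K) • 1
  have hT (v : L) : T v = ⁅h, v⁆ + (2 : K) • v := by simp [T]
  have hTN : ∀ v ∈ N, T v ∈ N := fun v hv ↦ by
    rw [hN] at hv ⊢
    rw [hT, lie_add, lie_add, hehv, hcomm, lie_smul, lie_smul, hv.1, hv.2]
    refine ⟨by simp, by rw [lie_neg]; module⟩
  have hinj : Function.Injective (T.restrict hTN) := by
    rw [injective_iff_map_eq_zero]
    rintro ⟨v, hv⟩ h0
    have h0 : T v = 0 := congrArg Subtype.val h0
    rw [hT] at h0
    refine Subtype.ext (Module.End.eq_zero_of_apply_eq_neg_two_smul (h := ad K L h)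
      (f := ad K L g) (isNilpotent_ad_of_lie_eq_self (K := K) hζe) ?_ ?_ (hN.mp hv).1 ?_)
    · rw [ad_mul_sub_mul, hg, map_smul]
    · rw [ad_mul_sub_mul, hh]
    · rw [ad_apply, eq_neg_of_add_eq_zero_left h0, neg_smul]
  have hTg : T g ∈ N := by
    rw [hN, hT, lie_add, lie_add, hehv, hcomm, lie_smul, lie_smul, hζg, ← hh, lie_self, lie_neg]
    exact ⟨by module, by module⟩
  obtain ⟨⟨w, hw⟩, hwg⟩ := LinearMap.injective_iff_surjective.mp hinj ⟨T g, hTg⟩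
  have hwg : T w = T g := congrArg Subtype.val hwg
  rw [hN] at hw
  rw [hT, hT] at hwg
  refine ⟨h, g - w, ⟨hg, ?_, ?_⟩, hζh, ?_⟩
  · rw [lie_sub, eq_sub_of_add_eq hwg]; module
  · rw [lie_sub, hw.1, hh, sub_zero]
  · rw [lie_sub, hζg, hw.2]; abel

end LieAlgebra

/-- Graded Jacobson–Morozov: let `g` be a finite-dimensional complex semisimple Lie algebra and
`ζ ∈ g` with `ad ζ` diagonalizable. If `e ≠ 0` and `⁅ζ, e⁆ = e`, then `e` can be completed to an
`sl₂`-triple `(h, e, f)` with `⁅ζ, h⁆ = 0` and `⁅ζ, f⁆ = -f`. -/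
theorem graded_jacobson_morozov {g : Type*} [LieRing g] [LieAlgebra ℂ g]
    [Module.Finite ℂ g] [LieAlgebra.IsSemisimple ℂ g]
    (ζ e : g)
    (hdiag : ⨆ μ : ℂ, Module.End.eigenspace (LieAlgebra.ad ℂ g ζ) μ = ⊤)
    (he : e ≠ 0) (hζe : ⁅ζ, e⁆ = e) :
    ∃ h f : g, IsSl2TripleIn h e f ∧ ⁅ζ, h⁆ = 0 ∧ ⁅ζ, f⁆ = -f :=
  LieAlgebra.exists_sl2_of_lie_eq_self hdiag hζe
end

section
/- Let g be a finite-dimensional complex semisimple Lie algebra and let ζ, e ∈ g with ⁅ζ, e⁆ = e. Suppose (h, e, f) and (h′, e, f′) are two sl₂-triples through the same element e with ⁅ζ, h⁆ = 0 and ⁅ζ, h′⁆ = 0. Then there exists Z ∈ g with ⁅ζ, Z⁆ = 0 and ⁅Z, e⁆ = 0 such that ad Z is nilpotent and the automorphism exp(ad Z) of g satisfies exp(ad Z)(e) = e, exp(ad Z)(h) = h′, and exp(ad Z)(f) = f′. (Proposition 2.14: any two sl₂-triples in g with the same e and with h, h′ ∈ g₀ are conjugate by an element of G₀ fixing e.)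 -/
/-- The exponential of an endomorphism of a finite-dimensional complex vector space, as a finite
sum `∑_{k ≤ dim} N^k / k!`.  For a nilpotent endomorphism `N` (whose nilpotency index is at most
`dim`), this is the usual exponential `exp N = ∑ N^k / k!`. -/
noncomputable def expNil {g : Type*} [AddCommGroup g] [Module ℂ g] [Module.Finite ℂ g]
    (N : Module.End ℂ g) : Module.End ℂ g :=
  ∑ k ∈ Finset.range (Module.finrank ℂ g + 1), (k.factorial : ℂ)⁻¹ • N ^ k

section CommutatorNilpotent

open Polynomial

variable {K A : Type*} [Field K] [Ring A] [Algebra K A]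

/-- If `c = ⁅a, b⁆` commutes with `a`, then `⁅·, b⁆` acts on polynomials in `a` as `c` times the
formal derivative. -/
lemma lie_aeval_eq_of_commute {a b : A} (h : Commute a ⁅a, b⁆) (p : K[X]) :
    ⁅aeval a p, b⁆ = aeval a (derivative p) * ⁅a, b⁆ := by
  induction p using Polynomial.induction_on' with
  | add p q hp hq =>
    rw [Ring.lie_def] at hp hq ⊢
    rw [map_add, map_add, map_add, add_mul _ _ ⁅a, b⁆, ← hp, ← hq]
    noncomm_ring
  | monomial n x =>
    simp only [aeval_monomial, derivative_monomial, map_mul, map_natCast]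
    suffices hs : ⁅a ^ n, b⁆ = n * a ^ (n - 1) * ⁅a, b⁆ by
      rw [Ring.lie_def] at hs
      rw [← Algebra.smul_def, Ring.lie_def, smul_mul_assoc, mul_smul_comm, ← smul_sub, hs,
        Algebra.smul_def]
      simp only [mul_assoc]
    induction n with
    | zero => simp [Ring.lie_def]
    | succ n ih =>
      have hstep : ⁅a ^ (n + 1), b⁆ = a * ⁅a ^ n, b⁆ + ⁅a, b⁆ * a ^ n := by
        simp only [Ring.lie_def, pow_succ']
        noncomm_ring
      rw [hstep, ih, ← (h.pow_left n).eq]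
      rcases n with _ | n
      · simp
      · have hc : a * ((n + 1 : ℕ) : A) = ((n + 1 : ℕ) : A) * a := (Nat.cast_commute _ a).symm.eq
        simp only [Nat.add_sub_cancel, ← mul_assoc, hc]
        rw [mul_assoc _ a, ← pow_succ']
        push_cast
        noncomm_ring

lemma isNilpotent_lie_of_aeval_mul_pow_eq_zero [CharZero K] {a b : A} (h : Commute a ⁅a, b⁆)
    {p : K[X]} (hp : p ≠ 0) {m : ℕ} (hpm : aeval a p * ⁅a, b⁆ ^ m = 0) :
    IsNilpotent ⁅a, b⁆ := by
  induction hn : p.natDegree using Nat.strong_induction_on generalizing p m with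
  | _ n ih =>
    subst hn
    by_cases hdeg : p.natDegree = 0
    · obtain ⟨x, rfl⟩ := natDegree_eq_zero.mp hdeg
      have hx : x ≠ 0 := by simpa using hp
      refine ⟨m, ?_⟩
      rw [aeval_C, ← Algebra.smul_def] at hpm
      exact (smul_eq_zero_iff_right hx).mp hpm
    · suffices h0 : aeval a (derivative p) * ⁅a, b⁆ ^ (m + 1 + m) = 0 from
        ih _ (natDegree_derivative_lt hdeg) (fun h' ↦ hdeg (derivative_eq_zero.mp h')) h0 rfl
      set c := ⁅a, b⁆ with hc
      have hcomm : Commute (aeval a p) c := .symm <|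
        Algebra.commute_of_mem_adjoin_singleton_of_commute (aeval_mem_adjoin_singleton K a) h.symm
      have hcomm' : Commute (aeval a (derivative p)) c := .symm <|
        Algebra.commute_of_mem_adjoin_singleton_of_commute (aeval_mem_adjoin_singleton K a) h.symm
      have hlie : aeval a (derivative p) * c = aeval a p * b - b * aeval a p := by
        rw [hc, ← lie_aeval_eq_of_commute h, Ring.lie_def]
      calc aeval a (derivative p) * c ^ (m + 1 + m)
          = aeval a (derivative p) * c ^ m * (c * c ^ m) := by
            rw [add_assoc, pow_add, add_comm 1 m, pow_succ', mul_assoc]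
        _ = c ^ m * (aeval a (derivative p) * c) * c ^ m := by
            rw [(hcomm'.pow_right m).eq]; simp only [mul_assoc]
        _ = c ^ m * aeval a p * b * c ^ m - c ^ m * b * (aeval a p * c ^ m) := by
            rw [hlie]; simp only [mul_sub, sub_mul, mul_assoc]
        _ = 0 := by simp [← (hcomm.pow_right m).eq, hpm]

/-- **Jacobson's lemma**: over a field of characteristic zero, a commutator `⁅a, b⁆` commuting with
an algebraic element `a` is nilpotent. -/
lemma isNilpotent_lie_of_commute [CharZero K] {a b : A} (ha : IsIntegral K a)
    (h : Commute a ⁅a, b⁆) : IsNilpotent ⁅a, b⁆ :=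
  isNilpotent_lie_of_aeval_mul_pow_eq_zero (K := K) h (minpoly.ne_zero ha) (m := 0) (by simp)

end CommutatorNilpotent

section Filtration

open LieAlgebra

variable {K L : Type*} [Field K] [LieRing L] [LieAlgebra K L]

/-- The decreasing filtration `ker (ad e) ⊓ range ((ad e) ^ k)` of the centralizer of `e`. -/
def centralizerFiltration (K : Type*) {L : Type*} [Field K] [LieRing L] [LieAlgebra K L]
    (e : L) (k : ℕ) : Submodule K L :=
  LinearMap.ker (ad K L e) ⊓ LinearMap.range ((ad K L e) ^ k)

lemma mem_centralizerFiltration {e x : L} {k : ℕ} :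
    x ∈ centralizerFiltration K e k ↔ ⁅e, x⁆ = 0 ∧ ∃ y, ((ad K L e) ^ k) y = x := by
  simp [centralizerFiltration]

lemma centralizerFiltration_antitone (e : L) : Antitone (centralizerFiltration K e) := by
  intro k l hkl x hx
  rw [mem_centralizerFiltration] at hx ⊢
  obtain ⟨hx, y, rfl⟩ := hx
  refine ⟨hx, ((ad K L e) ^ (l - k)) y, ?_⟩
  rw [← Module.End.mul_apply, ← pow_add, Nat.add_sub_cancel' hkl]

lemma lie_mem_centralizerFiltration [CharZero K] {e x y : L} {j k : ℕ}
    (hx : x ∈ centralizerFiltration K e j) (hy : y ∈ centralizerFiltration K e k) :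
    ⁅x, y⁆ ∈ centralizerFiltration K e (j + k) := by
  rw [mem_centralizerFiltration] at hx hy ⊢
  obtain ⟨hx, w, rfl⟩ := hx
  obtain ⟨hy, z, rfl⟩ := hy
  refine ⟨by rw [leibniz_lie, hx, hy, zero_lie, lie_zero, add_zero], ?_⟩
  have vanish {m n : ℕ} {v : L} (hv : ⁅e, ((ad K L e) ^ m) v⁆ = 0) (hmn : m < n) :
      ((ad K L e) ^ n) v = 0 := by
    obtain ⟨d, rfl⟩ := Nat.exists_eq_add_of_lt hmn
    rw [show m + d + 1 = d + (m + 1) by ring, pow_add, Module.End.mul_apply, pow_succ',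
      Module.End.mul_apply, ad_apply, hv, map_zero]
  have hc : ((j + k).choose j : K) ≠ 0 :=
    Nat.cast_ne_zero.mpr (Nat.choose_pos (Nat.le_add_right j k)).ne'
  refine ⟨((j + k).choose j : K)⁻¹ • ⁅w, z⁆, ?_⟩
  rw [map_smul, ad_pow_lie, Finset.sum_eq_single (j, k), ← Nat.cast_smul_eq_nsmul K, smul_smul,
    inv_mul_cancel₀ hc, one_smul]
  · rintro ⟨a, b⟩ hab hne
    replace hab : a + b = j + k := Finset.HasAntidiagonal.mem_antidiagonal.mp hab
    dsimp only
    rcases lt_trichotomy a j with h | h | h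
    · rw [vanish hy (by omega : k < b), lie_zero, smul_zero]
    · exact absurd (by rw [h, (by omega : b = k)]) hne
    · rw [vanish hx h, zero_lie, smul_zero]
  · simp

lemma exists_centralizerFiltration_eq_bot {e : L} (he : IsNilpotent (ad K L e)) :
    ∃ n, centralizerFiltration K e n = ⊥ := by
  obtain ⟨n, hn⟩ := he
  refine ⟨n, ?_⟩
  rw [centralizerFiltration, hn, LinearMap.range_zero, inf_bot_eq]

lemma isNilpotent_ad_of_mem_centralizerFiltration [CharZero K] [Module.Finite K L] {e x : L}
    (hx : x ∈ centralizerFiltration K e 1) : IsNilpotent (ad K L x) := by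
  obtain ⟨hx, y, rfl⟩ := mem_centralizerFiltration.mp hx
  rw [pow_one, ad_apply] at hx ⊢
  have had (u v : L) : ad K L ⁅u, v⁆ = ⁅ad K L u, ad K L v⁆ := by
    ext w
    simp [Ring.lie_def]
  rw [had]
  refine isNilpotent_lie_of_commute (K := K) (Algebra.IsIntegral.isIntegral _) ?_
  rw [← had, commute_iff_eq, ← sub_eq_zero, ← Ring.lie_def, ← had, hx, map_zero]

end Filtration

namespace IsSl2TripleIn

open LieAlgebra

variable {L : Type*} [LieRing L] [LieAlgebra ℂ L] {h e f : L}

lemma isNilpotent_ad [Module.Finite ℂ L] (t : IsSl2TripleIn h e f) :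
    IsNilpotent (ad ℂ L e) := by
  have he : e = ⁅e, -(2⁻¹ : ℂ) • h⁆ := by
    rw [lie_smul, ← lie_skew, t.1]
    module
  apply isNilpotent_ad_of_mem_centralizerFiltration (e := e)
  rw [mem_centralizerFiltration]
  exact ⟨lie_self e, _, by rw [pow_one, ad_apply, ← he]⟩

lemma ad_pow_succ_lie (t : IsSl2TripleIn h e f) (k : ℕ) (y : L) :
    ((ad ℂ L e) ^ (k + 1)) ⁅f, y⁆ = ⁅f, ((ad ℂ L e) ^ (k + 1)) y⁆ +
      (k + 1 : ℂ) • (⁅h, ((ad ℂ L e) ^ k) y⁆ - (k : ℂ) • ((ad ℂ L e) ^ k) y) := by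
  induction k with
  | zero => simp [leibniz_lie e f y, t.2.2, add_comm]
  | succ k ih =>
    have hf (w : L) : ⁅e, ⁅f, w⁆⁆ = ⁅h, w⁆ + ⁅f, ⁅e, w⁆⁆ := by rw [leibniz_lie, t.2.2]
    have hh (w : L) : ⁅e, ⁅h, w⁆⁆ = ⁅h, ⁅e, w⁆⁆ - (2 : ℂ) • ⁅e, w⁆ := by
      rw [leibniz_lie h e w, t.1, smul_lie]; abel
    have hp (n : ℕ) (w : L) : ((ad ℂ L e) ^ (n + 1)) w = ⁅e, ((ad ℂ L e) ^ n) w⁆ := by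
      rw [pow_succ', Module.End.mul_apply, ad_apply]
    rw [hp (k + 1), ih, hp (k + 1), lie_add, hf, lie_smul, lie_sub, hh, lie_smul, hp k]
    push_cast
    module

lemma lie_sub_smul_mem (t : IsSl2TripleIn h e f) {k : ℕ} {x : L}
    (hx : x ∈ centralizerFiltration ℂ e k) :
    ⁅h, x⁆ - (k : ℂ) • x ∈ centralizerFiltration ℂ e (k + 1) := by
  rw [mem_centralizerFiltration] at hx ⊢
  obtain ⟨hx, y, rfl⟩ := hx
  constructor
  · rw [lie_sub, lie_smul, hx, leibniz_lie, hx, ← lie_skew e h, t.1, neg_lie, smul_lie, hx]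
    simp
  · refine ⟨(k + 1 : ℂ)⁻¹ • ⁅f, y⁆, ?_⟩
    have hk : (k + 1 : ℂ) ≠ 0 := Nat.cast_add_one_ne_zero k
    rw [map_smul, t.ad_pow_succ_lie, pow_succ', Module.End.mul_apply, ad_apply, hx, lie_zero,
      zero_add, smul_smul, inv_mul_cancel₀ hk, one_smul]

lemma lie_mem (t : IsSl2TripleIn h e f) {k : ℕ} {x : L}
    (hx : x ∈ centralizerFiltration ℂ e k) : ⁅h, x⁆ ∈ centralizerFiltration ℂ e k := by
  have := centralizerFiltration_antitone e k.le_succ (t.lie_sub_smul_mem hx)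
  simpa using add_mem this (Submodule.smul_mem _ (k : ℂ) hx)

lemma sub_mem_of_left {h' f' : L} (t : IsSl2TripleIn h e f) (t' : IsSl2TripleIn h' e f') :
    h' - h ∈ centralizerFiltration ℂ e 1 := by
  rw [mem_centralizerFiltration]
  refine ⟨?_, f' - f, ?_⟩
  · rw [← lie_skew, sub_lie, t.1, t'.1, sub_self, neg_zero]
  · rw [pow_one, ad_apply, lie_sub, t.2.2, t'.2.2]

/-- An `sl₂`-triple is determined by its first two members. -/
lemma eq_of_eq [Module.Finite ℂ L] {f' : L} (t : IsSl2TripleIn h e f)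
    (t' : IsSl2TripleIn h e f') : f = f' := by
  have hmem (k : ℕ) : f - f' ∈ centralizerFiltration ℂ e k := by
    induction k with
    | zero =>
      refine mem_centralizerFiltration.mpr ⟨?_, f - f', by simp⟩
      rw [lie_sub, t.2.2, t'.2.2, sub_self]
    | succ k ih =>
      have hk : (k + 2 : ℂ) ≠ 0 := by exact_mod_cast (k + 1).succ_ne_zero
      have heq : ⁅h, f - f'⁆ - (k : ℂ) • (f - f') = -(k + 2 : ℂ) • (f - f') := by
        rw [lie_sub, t.2.1, t'.2.1]; module
      exact (Submodule.smul_mem_iff _ (neg_ne_zero.mpr hk)).mp (heq ▸ t.lie_sub_smul_mem ih)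
  obtain ⟨n, hn⟩ := exists_centralizerFiltration_eq_bot t.isNilpotent_ad
  exact sub_eq_zero.mp ((Submodule.mem_bot ℂ).mp (hn ▸ hmem n))

lemma ad_pow_succ_mem (t : IsSl2TripleIn h e f) {Z : L} (hZ : Z ∈ centralizerFiltration ℂ e 1)
    (n : ℕ) : ((ad ℂ L Z) ^ (n + 1)) h ∈ centralizerFiltration ℂ e (n + 1) := by
  induction n with
  | zero =>
    rw [zero_add, pow_one, ad_apply, ← lie_skew]
    exact neg_mem (t.lie_mem hZ)
  | succ n ih =>
    rw [pow_succ', Module.End.mul_apply, ad_apply, add_comm]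
    exact lie_mem_centralizerFiltration hZ ih

lemma ad_add_pow_succ_sub_mem (t : IsSl2TripleIn h e f) {Z z : L} {k : ℕ}
    (hZ : Z ∈ centralizerFiltration ℂ e 1) (hz : z ∈ centralizerFiltration ℂ e (k + 1)) (n : ℕ) :
    ((ad ℂ L (Z + z)) ^ (n + 1)) h - ((ad ℂ L Z) ^ (n + 1)) h ∈
      centralizerFiltration ℂ e (n + k + 1) := by
  induction n with
  | zero =>
    rw [zero_add, zero_add, pow_one, pow_one, ← LinearMap.sub_apply, ← map_sub, add_sub_cancel_left,
      ad_apply, ← lie_skew]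
    exact neg_mem (t.lie_mem hz)
  | succ n ih =>
    have hZz : Z + z ∈ centralizerFiltration ℂ e 1 :=
      add_mem hZ (centralizerFiltration_antitone e (by omega) hz)
    have heq : ((ad ℂ L (Z + z)) ^ (n + 1 + 1)) h - ((ad ℂ L Z) ^ (n + 1 + 1)) h =
        ⁅Z, ((ad ℂ L (Z + z)) ^ (n + 1)) h - ((ad ℂ L Z) ^ (n + 1)) h⁆ +
          ⁅z, ((ad ℂ L (Z + z)) ^ (n + 1)) h⁆ := by
      simp only [pow_succ' _ (n + 1), Module.End.mul_apply, ad_apply, add_lie, lie_sub]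
      abel
    rw [heq]
    refine add_mem ?_ ?_
    · have := lie_mem_centralizerFiltration hZ ih
      rwa [show 1 + (n + k + 1) = n + 1 + k + 1 by ring] at this
    · have := lie_mem_centralizerFiltration hz (t.ad_pow_succ_mem hZz n)
      rwa [show k + 1 + (n + 1) = n + 1 + k + 1 by ring] at this

lemma expNil_ad_add_sub_mem [Module.Finite ℂ L] (t : IsSl2TripleIn h e f) {Z z : L} {k : ℕ}
    (hZ : Z ∈ centralizerFiltration ℂ e 1) (hz : z ∈ centralizerFiltration ℂ e (k + 1)) :
    expNil (ad ℂ L (Z + z)) h - expNil (ad ℂ L Z) h - ⁅z, h⁆ ∈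
      centralizerFiltration ℂ e (k + 2) := by
  cases hr : Module.finrank ℂ L with
  | zero =>
    have := Module.finrank_zero_iff.mp hr
    rw [Subsingleton.elim (_ - _) (0 : L)]
    exact zero_mem _
  | succ r =>
    have heq : expNil (ad ℂ L (Z + z)) h - expNil (ad ℂ L Z) h - ⁅z, h⁆ =
        ∑ n ∈ Finset.range r, ((n + 1 + 1).factorial : ℂ)⁻¹ •
          (((ad ℂ L (Z + z)) ^ (n + 1 + 1)) h - ((ad ℂ L Z) ^ (n + 1 + 1)) h) := by
      simp only [expNil, hr, Finset.sum_range_succ',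
        smul_sub, Finset.sum_sub_distrib]
      simp
      abel
    rw [heq]
    refine sum_mem fun n _ ↦ Submodule.smul_mem _ _ ?_
    exact centralizerFiltration_antitone e (by omega) (t.ad_add_pow_succ_sub_mem hZ hz (n + 1))

end IsSl2TripleIn

section Exp

open LieAlgebra

variable {L : Type*} [LieRing L] [LieAlgebra ℂ L] [Module.Finite ℂ L]

lemma expNil_ad_apply_of_lie_eq_zero {Z x : L} (hx : ⁅Z, x⁆ = 0) : expNil (ad ℂ L Z) x = x := by
  simp [expNil, LinearMap.sum_apply, Finset.sum_range_succ', pow_succ, hx]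

lemma lie_expNil_ad_apply_eq_zero {ζ Z x : L} (hZ : ⁅ζ, Z⁆ = 0) (hx : ⁅ζ, x⁆ = 0) :
    ⁅ζ, expNil (ad ℂ L Z) x⁆ = 0 := by
  have hpow (n : ℕ) : ⁅ζ, ((ad ℂ L Z) ^ n) x⁆ = 0 := by
    induction n with
    | zero => simpa
    | succ n ih =>
      rw [pow_succ', Module.End.mul_apply, ad_apply, leibniz_lie, hZ, ih, zero_lie, lie_zero,
        add_zero]
  simp [expNil, LinearMap.sum_apply, lie_sum, hpow]

lemma expNil_ad_lie {Z : L} (hZ : IsNilpotent (ad ℂ L Z)) (x y : L) :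
    expNil (ad ℂ L Z) ⁅x, y⁆ = ⁅expNil (ad ℂ L Z) x, expNil (ad ℂ L Z) y⁆ := by
  let _ : Module ℚ L := Module.compHom L (algebraMap ℚ ℂ)
  let _ : LieAlgebra ℚ L := { lie_smul := fun q x y ↦ lie_smul (algebraMap ℚ ℂ q) x y }
  have hpow : (ad ℂ L Z) ^ (Module.finrank ℂ L + 1) = 0 := by
    have hn := (LinearMap.isNilpotent_iff_charpoly _).mp hZ
    have := LinearMap.aeval_self_charpoly (ad ℂ L Z)
    rw [hn, map_pow, Polynomial.aeval_X] at this
    rw [pow_succ, this, zero_mul]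
  have hexp : expNil (ad ℂ L Z) = IsNilpotent.exp (ad ℂ L Z) := by
    rw [IsNilpotent.exp_eq_sum hpow, expNil]
    exact Finset.sum_congr rfl fun n _ ↦ inv_natCast_smul_eq ℂ ℚ _ _
  have hD : (LieDerivation.ad ℂ L Z).toLinearMap = ad ℂ L Z := by
    ext; simp
  have := (LieDerivation.exp (LieDerivation.ad ℂ L Z) (hD ▸ hZ)).map_lie x y
  simpa only [LieDerivation.exp_map_apply, hD, ← hexp] using this

end Exp

/-- Successive approximation along the filtration of the centralizer of `e`. -/
lemma IsSl2TripleIn.exists_sub_expNil_mem {L : Type*} [LieRing L] [LieAlgebra ℂ L]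
    [Module.Finite ℂ L] {ζ h e f h' f' : L} (t : IsSl2TripleIn h e f)
    (t' : IsSl2TripleIn h' e f') (hζh : ⁅ζ, h⁆ = 0) (hζh' : ⁅ζ, h'⁆ = 0) (k : ℕ) :
    ∃ Z ∈ centralizerFiltration ℂ e 1, ⁅ζ, Z⁆ = 0 ∧
      h' - expNil (LieAlgebra.ad ℂ L Z) h ∈ centralizerFiltration ℂ e (k + 1) := by
  induction k with
  | zero =>
    refine ⟨0, zero_mem _, lie_zero ζ, ?_⟩
    rw [expNil_ad_apply_of_lie_eq_zero (zero_lie h)]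
    exact t.sub_mem_of_left t'
  | succ k ih =>
    obtain ⟨Z, hZ, hζZ, hd⟩ := ih
    set d := h' - expNil (LieAlgebra.ad ℂ L Z) h with hd_def
    have hζd : ⁅ζ, d⁆ = 0 := by
      rw [hd_def, lie_sub, hζh', lie_expNil_ad_apply_eq_zero hζZ hζh, sub_zero]
    have hz := Submodule.smul_mem _ (-(k + 1 : ℂ)⁻¹) hd
    refine ⟨Z + -(k + 1 : ℂ)⁻¹ • d, add_mem hZ (centralizerFiltration_antitone e (by omega) hz),
      by rw [lie_add, lie_smul, hζZ, hζd, smul_zero, add_zero], ?_⟩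
    have h₁ := t.expNil_ad_add_sub_mem hZ hz
    have h₂ := Submodule.smul_mem _ (-(k + 1 : ℂ)⁻¹) (t.lie_sub_smul_mem hd)
    have hk : (k + 1 : ℂ) ≠ 0 := Nat.cast_add_one_ne_zero k
    have hkd : -(k + 1 : ℂ)⁻¹ • (⁅h, d⁆ - ((k + 1 : ℕ) : ℂ) • d) =
        d + (k + 1 : ℂ)⁻¹ • ⁅d, h⁆ := by
      rw [smul_sub, smul_smul, ← lie_skew h d, Nat.cast_succ, neg_mul, inv_mul_cancel₀ hk]
      module
    rw [hkd] at h₂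
    have h₃ := sub_mem h₂ h₁
    rw [smul_lie] at h₃
    convert h₃ using 1
    nth_rewrite 2 [hd_def]
    module

/-- Let `g` be a finite-dimensional complex semisimple Lie algebra, `ζ, e ∈ g` with
`⁅ζ, e⁆ = e`.  If `(h, e, f)` and `(h', e, f')` are two `sl₂`-triples through the same `e`
with `⁅ζ, h⁆ = 0` and `⁅ζ, h'⁆ = 0`, then there exists `Z` with `⁅ζ, Z⁆ = 0`, `⁅Z, e⁆ = 0`,
`ad Z` nilpotent, such that the automorphism `exp (ad Z)` fixes `e` and carries `h` to `h'`
and `f` to `f'`. -/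
theorem sl2Triples_conjugate {g : Type*} [LieRing g] [LieAlgebra ℂ g]
    [Module.Finite ℂ g] [LieAlgebra.IsSemisimple ℂ g]
    (ζ e : g) (hζe : ⁅ζ, e⁆ = e)
    (h f h' f' : g) (h1 : IsSl2TripleIn h e f) (h2 : IsSl2TripleIn h' e f')
    (hζh : ⁅ζ, h⁆ = 0) (hζh' : ⁅ζ, h'⁆ = 0) :
    ∃ Z : g, ⁅ζ, Z⁆ = 0 ∧ ⁅Z, e⁆ = 0 ∧ IsNilpotent (LieAlgebra.ad ℂ g Z) ∧
      expNil (LieAlgebra.ad ℂ g Z) e = e ∧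
      expNil (LieAlgebra.ad ℂ g Z) h = h' ∧
      expNil (LieAlgebra.ad ℂ g Z) f = f' := by
  obtain ⟨n, hn⟩ := exists_centralizerFiltration_eq_bot h1.isNilpotent_ad
  obtain ⟨Z, hZ, hζZ, hmem⟩ := h1.exists_sub_expNil_mem h2 hζh hζh' n
  have hZe : ⁅Z, e⁆ = 0 := by
    rw [← lie_skew, (mem_centralizerFiltration.mp hZ).1, neg_zero]
  have hnil := isNilpotent_ad_of_mem_centralizerFiltration hZ
  have hexp_e := expNil_ad_apply_of_lie_eq_zero hZe
  have hexp_h : expNil (LieAlgebra.ad ℂ g Z) h = h' := by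
    have := centralizerFiltration_antitone e n.le_succ hmem
    rw [hn, Submodule.mem_bot, sub_eq_zero] at this
    exact this.symm
  refine ⟨Z, hζZ, hZe, hnil, hexp_e, hexp_h, ?_⟩
  have h3 : IsSl2TripleIn h' e (expNil (LieAlgebra.ad ℂ g Z) f) := by
    refine ⟨h2.1, ?_, ?_⟩
    · rw [← hexp_h, ← expNil_ad_lie hnil, h1.2.1, map_smul]
    · rw [← hexp_h, ← h1.2.2, expNil_ad_lie hnil, hexp_e]
  exact h3.eq_of_eq h2
end
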